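/- An irrational real number ξ is extremal with an associated Fibonacci sequence all of whose terms lie in 𝒮 if and only if its continued fraction expansion is of the form ξ = [0, a₁, a₂, …], where the infinite word (a₁, a₂, …) is the limit of a Fibonacci sequence of words (w_i)_{i≥1} over the positive integers starting with two words w₁, w₂ with w₁w₂ ≠ w₂w₁. -/

import Mathlib

open Matrix

/-- 2×2 integer matrices. -/
abbrev M2 : Type := Matrix (Fin 2) (Fin 2) ℤ

/-- The content of an integer matrix: the gcd of its coefficients. -/
def content (A : M2) : ℕ :=
  Nat.gcd (Nat.gcd (A 0 0).natAbs (A 0 1).natAbs) (Nat.gcd (A 1 0).natAbs (A 1 1).natAbs)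

/-- A matrix is primitive if its content is 1. -/
def Primitive (A : M2) : Prop := content A = 1

/-- Membership in 𝒫: primitive with nonzero determinant. -/
def MemP (A : M2) : Prop := Primitive A ∧ A.det ≠ 0

/-- `A^red`: the primitive matrix such that `A = content A • A^red`. -/
def red (A : M2) : M2 := Matrix.of fun i j => A i j / (content A : ℤ)

/-- The group operation of 𝒫: `A * B = (AB)^red`. -/
def pmul (A B : M2) : M2 := red (A * B)

/-- A Fibonacci sequence in 𝒫 (indices from 1). -/
def IsFibP (W : ℕ → M2) : Prop :=
  (∀ i, 1 ≤ i → MemP (W i)) ∧ ∀ i, 1 ≤ i → W (i + 2) = pmul (W (i + 1)) (W i)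

/-- Admissibility of a Fibonacci sequence in 𝒫: there is a non-symmetric,
non-skew-symmetric N ∈ 𝒫 such that W_i N_i is symmetric for all i ≥ 1,
where N_i = ᵗN for odd i and N_i = N for even i. -/
def AdmissibleFib (W : ℕ → M2) : Prop :=
  ∃ N : M2, MemP N ∧ N ≠ Nᵀ ∧ N ≠ -Nᵀ ∧
    ∀ i, 1 ≤ i → (W i * (if i % 2 = 1 then Nᵀ else N)).IsSymm

/-- The norm of an integer 2×2 matrix: max absolute value of coefficients, as a real. -/
noncomputable def mnorm (A : M2) : ℝ :=
  max (max |(A 0 0 : ℝ)| |(A 0 1 : ℝ)|) (max |(A 1 0 : ℝ)| |(A 1 1 : ℝ)|)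

/-- The sequence is unbounded in norm. -/
def UnboundedSeq (W : ℕ → M2) : Prop := ∀ C : ℝ, ∃ i, 1 ≤ i ∧ C < mnorm (W i)

/-- The golden ratio γ = (1+√5)/2. -/
noncomputable def gam : ℝ := (1 + Real.sqrt 5) / 2

/-- Norm of the row vector (ξ, -1)·A. -/
noncomputable def xiNorm (ξ : ℝ) (A : M2) : ℝ :=
  max |ξ * (A 0 0 : ℝ) - (A 1 0 : ℝ)| |ξ * (A 0 1 : ℝ) - (A 1 1 : ℝ)|

/-- ξ is extremal: neither rational nor quadratic over ℚ, and for each X ≥ 1 the system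
|x₀| ≤ X, |x₀ξ - x₁| ≤ c X^(-1/γ), |x₀ξ² - x₂| ≤ c X^(-1/γ) has a nonzero integer solution. -/
def IsExtremal (ξ : ℝ) : Prop :=
  (∀ a b c : ℚ, ¬(a = 0 ∧ b = 0 ∧ c = 0) → (a : ℝ) * ξ ^ 2 + (b : ℝ) * ξ + (c : ℝ) ≠ 0) ∧
  ∃ c : ℝ, 0 < c ∧ ∀ X : ℝ, 1 ≤ X → ∃ x₀ x₁ x₂ : ℤ,
    ¬(x₀ = 0 ∧ x₁ = 0 ∧ x₂ = 0) ∧ |(x₀ : ℝ)| ≤ X ∧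
    |(x₀ : ℝ) * ξ - (x₁ : ℝ)| ≤ c * X ^ (-1 / gam) ∧
    |(x₀ : ℝ) * ξ ^ 2 - (x₂ : ℝ)| ≤ c * X ^ (-1 / gam)

/-- The Fibonacci sequence `W` in 𝒫 is associated to the extremal real number ξ:
it is an unbounded admissible Fibonacci sequence in 𝒫 with
‖W_{i+1}‖ ≍ ‖W_i‖^γ, ‖(ξ,-1)W_i‖ ≍ ‖W_i‖⁻¹ and |det W_i| ≍ 1. -/
def IsAssociated (ξ : ℝ) (W : ℕ → M2) : Prop :=
  IsFibP W ∧ UnboundedSeq W ∧ AdmissibleFib W ∧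
  ∃ c₁ c₂ c₃ c₄ c₅ c₆ : ℝ, 0 < c₁ ∧ 0 < c₂ ∧ 0 < c₃ ∧ 0 < c₄ ∧ 0 < c₅ ∧ 0 < c₆ ∧
    ∀ i, 1 ≤ i →
      c₁ * mnorm (W i) ^ gam ≤ mnorm (W (i + 1)) ∧
      mnorm (W (i + 1)) ≤ c₂ * mnorm (W i) ^ gam ∧
      c₃ * (mnorm (W i))⁻¹ ≤ xiNorm ξ (W i) ∧
      xiNorm ξ (W i) ≤ c₄ * (mnorm (W i))⁻¹ ∧
      c₅ ≤ |((W i).det : ℝ)| ∧ |((W i).det : ℝ)| ≤ c₆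

/-- Membership in GL₂(ℤ): integer matrix of determinant ±1. -/
def InGL2Z (A : M2) : Prop := A.det = 1 ∨ A.det = -1

/-- ξ is badly approximable: irrational and |ξ - p/q| > c/q² for all rationals p/q. -/
def BadlyApprox (ξ : ℝ) : Prop :=
  Irrational ξ ∧ ∃ c : ℝ, 0 < c ∧ ∀ p q : ℤ, q ≠ 0 → c / (q : ℝ) ^ 2 < |ξ - (p : ℝ) / (q : ℝ)|

/-- Partial quotients of the continued fraction expansion: `cfA n ξ` is `aₙ`
where ξ = [a₀, a₁, a₂, …]. -/
noncomputable def cfA : ℕ → ℝ → ℤ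
  | 0, ξ => ⌊ξ⌋
  | n + 1, ξ => cfA n (ξ - ⌊ξ⌋)⁻¹

/-- A Fibonacci sequence of words (indices from 1). -/
def FibWordSeq {α : Type} (w : ℕ → List α) : Prop := ∀ i, 1 ≤ i → w (i + 2) = w (i + 1) ++ w i

/-- `b` (indexed from 1: the limit word is b₁b₂b₃…) is the infinite limit word of the
sequence of words `w`: every `w k` (k ≥ 2) is a prefix of it, and their lengths are unbounded. -/
def IsLimitWord {α : Type} (w : ℕ → List α) (b : ℕ → α) : Prop :=
  (∀ n : ℕ, ∃ k, 2 ≤ k ∧ n ≤ (w k).length) ∧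
  ∀ k, 2 ≤ k → ∀ j, (h : j < (w k).length) → (w k).get ⟨j, h⟩ = b (j + 1)

/-- The Fibonacci sequence of words over the alphabet E = {a, b} (with `b = false`,
`a = true`): w₁ = b, w₂ = a, w_{k+2} = w_{k+1} w_k.  Its limit is f_{a,b}. -/
def fw : ℕ → List Bool
  | 0 => []
  | 1 => [false]
  | 2 => [true]
  | n + 3 => fw (n + 2) ++ fw (n + 1)

/-- The prefix of length `i` of the infinite Fibonacci word `f_{a,b}`
(note `fw (i+2)` is a prefix of `f_{a,b}` of length ≥ i). -/
def fpref (i : ℕ) : List Bool := (fw (i + 2)).take i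

/-- The monoid morphism Φ : E* → (𝒫, *) with Φ(b) = W₁, Φ(a) = W₂
(the letter `b` is `false` and `a` is `true`). -/
def PhiW (W1 W2 : M2) : List Bool → M2
  | [] => 1
  | x :: u => pmul (if x then W2 else W1) (PhiW W1 W2 u)

/-- The set 𝒮₁ of real matrices (a b; c d) with a ≥ max{b,c} and min{b,c} ≥ d ≥ 0. -/
def S1 : Set (Matrix (Fin 2) (Fin 2) ℝ) :=
  {A | max (A 0 1) (A 1 0) ≤ A 0 0 ∧ A 1 1 ≤ min (A 0 1) (A 1 0) ∧ 0 ≤ A 1 1}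

/-- The set 𝒮 = 𝒮₁ ∩ GL₂(ℤ), viewed as a set of integer matrices. -/
def Sset : Set M2 :=
  {A | (A.map (Int.cast : ℤ → ℝ)) ∈ S1 ∧ (A.det = 1 ∨ A.det = -1)}

/-- ξ is an extremal real number with an associated Fibonacci sequence in GL₂(ℤ). -/
def HasGLAssoc (ξ : ℝ) : Prop :=
  IsExtremal ξ ∧ ∃ W : ℕ → M2, IsAssociated ξ W ∧ ∀ i, 1 ≤ i → InGL2Z (W i)

/-- ξ is an extremal real number with an associated Fibonacci sequence in 𝒮. -/
def HasSAssoc (ξ : ℝ) : Prop :=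
  IsExtremal ξ ∧ ∃ W : ℕ → M2, IsAssociated ξ W ∧ ∀ i, 1 ≤ i → W i ∈ Sset

/-! ### Content and reduction -/

lemma content_dvd (A : M2) (i j : Fin 2) : (content A : ℤ) ∣ A i j := by
  rw [Int.natCast_dvd]
  fin_cases i <;> fin_cases j
  · exact (Nat.gcd_dvd_left _ _).trans (Nat.gcd_dvd_left _ _)
  · exact (Nat.gcd_dvd_left _ _).trans (Nat.gcd_dvd_right _ _)
  · exact (Nat.gcd_dvd_right _ _).trans (Nat.gcd_dvd_left _ _)
  · exact (Nat.gcd_dvd_right _ _).trans (Nat.gcd_dvd_right _ _)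

lemma content_smul_red (A : M2) : (content A : ℤ) • red A = A := by
  ext i j
  simp only [Matrix.smul_apply, red, Matrix.of_apply, smul_eq_mul]
  exact Int.mul_ediv_cancel' (content_dvd A i j)

lemma content_natCast_smul (k : ℕ) (A : M2) : content ((k : ℤ) • A) = k * content A := by
  simp [content, Int.natAbs_mul, Nat.gcd_mul_left]

lemma content_pos {A : M2} (hA : A.det ≠ 0) : 0 < content A := by
  rw [Nat.pos_iff_ne_zero]
  intro h
  apply hA
  rw [← content_smul_red A, h]
  simp

lemma primitive_red {A : M2} (hA : A.det ≠ 0) : Primitive (red A) := by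
  have h := content_natCast_smul (content A) (red A)
  rw [content_smul_red] at h
  exact (Nat.eq_of_mul_eq_mul_left (content_pos hA) (by rw [← h, mul_one])).symm

lemma content_eq_one {A : M2} (hA : InGL2Z A) : content A = 1 := by
  have h : (content A : ℤ) ∣ A.det := by
    rw [Matrix.det_fin_two]
    exact dvd_sub (Dvd.dvd.mul_right (content_dvd A 0 0) _)
      (Dvd.dvd.mul_right (content_dvd A 0 1) _)
  have h1 : (content A : ℤ) ∣ 1 := by
    rcases hA with hA | hA <;> rw [hA] at h <;> simpa using h
  exact_mod_cast Int.eq_one_of_dvd_one (by positivity) h1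

lemma memP_of_inGL2Z {A : M2} (hA : InGL2Z A) : MemP A :=
  ⟨content_eq_one hA, by rcases hA with h | h <;> rw [h] <;> decide⟩

lemma InGL2Z.mul {A B : M2} (hA : InGL2Z A) (hB : InGL2Z B) : InGL2Z (A * B) := by
  unfold InGL2Z at *
  rw [Matrix.det_mul]
  rcases hA with h | h <;> rcases hB with h' | h' <;> rw [h, h'] <;> decide

lemma pmul_eq_mul {A B : M2} (hA : InGL2Z A) (hB : InGL2Z B) : pmul A B = A * B := by
  have h := content_smul_red (A * B)
  rwa [content_eq_one (hA.mul hB), Nat.cast_one, one_smul] at h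

/-! ### The set `Sset` -/

lemma mem_Sset_iff {A : M2} : A ∈ Sset ↔
    (A 0 1 ≤ A 0 0 ∧ A 1 0 ≤ A 0 0 ∧ A 1 1 ≤ A 0 1 ∧ A 1 1 ≤ A 1 0 ∧ 0 ≤ A 1 1) ∧
      InGL2Z A := by
  simp only [Sset, S1, InGL2Z, Set.mem_ofPred_eq, Matrix.map_apply, max_le_iff, le_min_iff]
  norm_cast
  tauto

lemma det_eq_of_mem_Sset {A : M2} (hA : A ∈ Sset) :
    A 0 0 * A 1 1 - A 0 1 * A 1 0 = 1 ∨ A 0 0 * A 1 1 - A 0 1 * A 1 0 = -1 := by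
  have := (mem_Sset_iff.1 hA).2
  rwa [InGL2Z, Matrix.det_fin_two] at this

lemma one_le_of_mem_Sset {A : M2} (hA : A ∈ Sset) : 1 ≤ A 0 1 ∧ 1 ≤ A 1 0 ∧ 1 ≤ A 0 0 := by
  obtain ⟨⟨h1, h2, h3, h4, h5⟩, -⟩ := mem_Sset_iff.1 hA
  have hd := det_eq_of_mem_Sset hA
  have hb : A 0 1 ≠ 0 := by
    intro h
    have : A 1 1 = 0 := by omega
    simp [h, this] at hd
  have hc : A 1 0 ≠ 0 := by
    intro h
    have : A 1 1 = 0 := by omega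
    simp [h, this] at hd
  omega

lemma one_notMem_Sset : (1 : M2) ∉ Sset := by
  intro h
  simpa using (one_le_of_mem_Sset h).1

lemma mul_mem_Sset {A B : M2} (hA : A ∈ Sset) (hB : B ∈ Sset) : A * B ∈ Sset := by
  obtain ⟨⟨h1, h2, h3, h4, h5⟩, h6⟩ := mem_Sset_iff.1 hA
  obtain ⟨⟨k1, k2, k3, k4, k5⟩, k6⟩ := mem_Sset_iff.1 hB
  refine mem_Sset_iff.2 ⟨?_, h6.mul k6⟩
  simp only [Matrix.mul_apply, Fin.sum_univ_two]
  have hb : 0 ≤ A 0 1 := h5.trans h3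
  have hc : 0 ≤ A 1 0 := h5.trans h4
  have ha : 0 ≤ A 0 0 := hb.trans h1
  have kb : 0 ≤ B 0 1 := k5.trans k3
  have kc : 0 ≤ B 1 0 := k5.trans k4
  have ka : 0 ≤ B 0 0 := kb.trans k1
  refine ⟨?_, ?_, ?_, ?_, ?_⟩
  · gcongr
  · gcongr
  · gcongr
  · gcongr
  · positivity

lemma mnorm_eq_of_mem_Sset {A : M2} (hA : A ∈ Sset) : mnorm A = A 0 0 := by
  obtain ⟨⟨h1, h2, h3, h4, h5⟩, -⟩ := mem_Sset_iff.1 hA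
  have a1 : (A 0 1 : ℝ) ≤ A 0 0 := by exact_mod_cast h1
  have a2 : (A 1 0 : ℝ) ≤ A 0 0 := by exact_mod_cast h2
  have a3 : (A 1 1 : ℝ) ≤ A 0 1 := by exact_mod_cast h3
  have a4 : (A 1 1 : ℝ) ≤ A 1 0 := by exact_mod_cast h4
  have a5 : (0 : ℝ) ≤ A 1 1 := by exact_mod_cast h5
  rw [mnorm, abs_of_nonneg (by linarith), abs_of_nonneg (by linarith),
    abs_of_nonneg (by linarith), abs_of_nonneg (by linarith), max_eq_left a1, max_eq_left a4,
    max_eq_left a2]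

lemma mul_apply_zero_zero_bounds {A B : M2} (hA : A ∈ Sset) (hB : B ∈ Sset) :
    A 0 0 * B 0 0 < (A * B) 0 0 ∧ (A * B) 0 0 ≤ 2 * (A 0 0 * B 0 0) := by
  obtain ⟨⟨h1, -⟩, -⟩ := mem_Sset_iff.1 hA
  obtain ⟨⟨-, k2, -⟩, -⟩ := mem_Sset_iff.1 hB
  obtain ⟨hb, -, ha⟩ := one_le_of_mem_Sset hA
  obtain ⟨-, kc, ka⟩ := one_le_of_mem_Sset hB
  simp only [Matrix.mul_apply, Fin.sum_univ_two]
  constructor <;> nlinarith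

/-! ### Matrices of words -/

/-- The elementary continued fraction matrix of a partial quotient. -/
def cfMat (n : ℕ+) : M2 := !![((n : ℕ) : ℤ), 1; 1, 0]

/-- The product of the elementary matrices of the letters of a word. -/
def wordMat (l : List ℕ+) : M2 := (l.map cfMat).prod

@[simp] lemma wordMat_nil : wordMat [] = 1 := rfl

lemma wordMat_cons (n : ℕ+) (l : List ℕ+) : wordMat (n :: l) = cfMat n * wordMat l := by
  simp [wordMat]

lemma wordMat_append (l l' : List ℕ+) : wordMat (l ++ l') = wordMat l * wordMat l' := by
  simp [wordMat]

lemma cfMat_mul (n : ℕ+) (A : M2) : cfMat n * A =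
    !![((n : ℕ) : ℤ) * A 0 0 + A 1 0, ((n : ℕ) : ℤ) * A 0 1 + A 1 1; A 0 0, A 0 1] := by
  ext i j
  fin_cases i <;> fin_cases j <;> simp [cfMat, Matrix.mul_apply, Fin.sum_univ_two]

lemma cfMat_mem_Sset (n : ℕ+) : cfMat n ∈ Sset := by
  have : (1 : ℤ) ≤ ((n : ℕ) : ℤ) := by exact_mod_cast n.pos
  refine mem_Sset_iff.2 ⟨by simpa [cfMat] using this, Or.inr (by simp [cfMat])⟩

lemma wordMat_mem_Sset {l : List ℕ+} (hl : l ≠ []) : wordMat l ∈ Sset := by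
  induction l with
  | nil => exact absurd rfl hl
  | cons n l ih =>
    rw [wordMat_cons]
    rcases eq_or_ne l [] with rfl | h
    · simpa using cfMat_mem_Sset n
    · exact mul_mem_Sset (cfMat_mem_Sset n) (ih h)

lemma cfMat_mul_inj {m n : ℕ+} {A B : M2} (hA : A ∈ Sset) (hB : B ∈ Sset)
    (h : cfMat m * A = cfMat n * B) : m = n ∧ A = B := by
  rw [cfMat_mul, cfMat_mul] at h
  obtain ⟨⟨-, h2, -⟩, -⟩ := mem_Sset_iff.1 hA
  obtain ⟨⟨-, k2, -⟩, -⟩ := mem_Sset_iff.1 hB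
  obtain ⟨-, hc, ha⟩ := one_le_of_mem_Sset hA
  obtain ⟨-, kc, ka⟩ := one_le_of_mem_Sset hB
  have e00 := congrFun (congrFun h 0) 0
  have e01 := congrFun (congrFun h 0) 1
  have e10 := congrFun (congrFun h 1) 0
  have e11 := congrFun (congrFun h 1) 1
  simp at e00 e01 e10 e11
  have hmn : ((m : ℕ) : ℤ) = ((n : ℕ) : ℤ) := by
    rcases lt_trichotomy ((m : ℕ) : ℤ) ((n : ℕ) : ℤ) with hlt | heq | hlt
    · nlinarith
    · exact heq
    · nlinarith
  rw [hmn, e10] at e00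
  rw [hmn, e11] at e01
  refine ⟨PNat.eq (by exact_mod_cast hmn), ?_⟩
  ext i j
  fin_cases i <;> fin_cases j <;> simp <;> linarith

lemma wordMat_injective : Function.Injective wordMat := by
  intro l
  induction l with
  | nil =>
    intro l' h
    by_contra hne
    have := wordMat_mem_Sset (Ne.symm hne)
    rw [← h] at this
    exact one_notMem_Sset this
  | cons m l ih =>
    intro l' h
    cases l' with
    | nil =>
      have := wordMat_mem_Sset (List.cons_ne_nil m l)
      rw [h] at this
      exact absurd this one_notMem_Sset
    | cons n l' =>
      rw [wordMat_cons, wordMat_cons] at h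
      have h11 := congrFun (congrFun h 1) 1
      rcases eq_or_ne l [] with rfl | hl <;> rcases eq_or_ne l' [] with rfl | hl'
      · have h00 := congrFun (congrFun h 0) 0
        simp [cfMat] at h00
        rw [h00]
      · have := (one_le_of_mem_Sset (wordMat_mem_Sset hl')).1
        rw [cfMat_mul, cfMat_mul] at h11
        simp at h11
        omega
      · have := (one_le_of_mem_Sset (wordMat_mem_Sset hl)).1
        rw [cfMat_mul, cfMat_mul] at h11
        simp at h11
        omega
      · obtain ⟨hmn, hll⟩ := cfMat_mul_inj (wordMat_mem_Sset hl) (wordMat_mem_Sset hl') h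
        rw [hmn, ih hll]

lemma exists_pnat_eq {x : ℤ} (hx : 1 ≤ x) : ∃ n : ℕ+, ((n : ℕ) : ℤ) = x :=
  ⟨x.toNat.toPNat (by omega), Int.toNat_of_nonneg (by omega)⟩

lemma exists_cfMat_mul_of_mem_Sset {A : M2} (hA : A ∈ Sset) (hd : A 1 1 ≠ 0) :
    ∃ (n : ℕ+) (B : M2), B ∈ Sset ∧ A = cfMat n * B ∧ B 0 0 < A 0 0 := by
  obtain ⟨⟨h1, h2, h3, h4, h5⟩, -⟩ := mem_Sset_iff.1 hA
  obtain ⟨hb, hc, -⟩ := one_le_of_mem_Sset hA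
  have hdet := det_eq_of_mem_Sset hA
  set a := A 0 0 with ha
  set b := A 0 1 with hb'
  set c := A 1 0 with hc'
  set d := A 1 1 with hd'
  suffices H : ∃ x : ℤ, 1 ≤ x ∧ b - x * d ≤ d ∧ 0 ≤ b - x * d ∧ b - x * d ≤ a - x * c ∧
      a - x * c ≤ c by
    obtain ⟨x, hx, e1, e2, e3, e4⟩ := H
    have hB : (!![c, d; a - x * c, b - x * d] : M2) ∈ Sset := by
      refine mem_Sset_iff.2 ⟨?_, ?_⟩
      · simp
        omega
      · rw [InGL2Z, Matrix.det_fin_two]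
        simp only [Matrix.of_apply, Matrix.cons_val', Matrix.cons_val_zero, Matrix.cons_val_one,
          Matrix.cons_val_fin_one]
        rcases hdet with h | h
        · right; linarith
        · left; linarith
    obtain ⟨n, hn⟩ := exists_pnat_eq hx
    refine ⟨n, !![c, d; a - x * c, b - x * d], hB, ?_, ?_⟩
    · rw [cfMat_mul]
      ext i j
      fin_cases i <;> fin_cases j <;> simp [hn, ha, hb', hc', hd']
    · have := (one_le_of_mem_Sset hB).2.1
      simp at this ⊢
      nlinarith
  rcases lt_or_ge 1 d with hd1 | hd1
  · have hs := Int.emod_add_mul_ediv b d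
    have hs0 := Int.emod_nonneg b (by omega : d ≠ 0)
    have hs1 := Int.emod_lt_of_pos b (by omega : 0 < d)
    have hx : 1 ≤ b / d := by
      rw [Int.le_ediv_iff_mul_le (by omega)]
      omega
    set x := b / d
    set s := b % d
    have hbs : b - x * d = s := by linarith
    have hr : d * (a - x * c) = c * s + (a * d - b * c) := by rw [← hbs]; ring
    refine ⟨x, hx, by omega, by omega, ?_, ?_⟩
    · rw [hbs]
      by_contra hlt
      push Not at hlt
      rcases hdet with h | h <;> rw [h] at hr <;> nlinarith
    · by_contra hlt
      push Not at hlt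
      rcases hdet with h | h <;> rw [h] at hr <;> nlinarith
  · have hd1 : d = 1 := by omega
    rw [hd1] at hdet ⊢
    rcases hdet with h | h
    · exact ⟨b, hb, by omega, by omega, by linarith, by linarith⟩
    · have hc2 : c ≠ 1 := by rintro hc; rw [hc] at h; omega
      have hb2 : b ≠ 1 := by rintro hb; rw [hb] at h; omega
      refine ⟨b - 1, by omega, by linarith, by linarith, ?_, by linarith⟩
      have : 2 ≤ c := by omega
      linarith

lemma exists_wordMat_eq {A : M2} (hA : A ∈ Sset) : ∃ l : List ℕ+, l ≠ [] ∧ wordMat l = A := by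
  induction hn : (A 0 0).toNat using Nat.strong_induction_on generalizing A with
  | _ k ih =>
  by_cases hd : A 1 1 = 0
  · obtain ⟨hb, hc, ha⟩ := one_le_of_mem_Sset hA
    have hdet := det_eq_of_mem_Sset hA
    rw [hd] at hdet
    have hbc : A 0 1 = 1 ∧ A 1 0 = 1 := by
      rcases hdet with h | h
      · nlinarith
      · constructor <;> nlinarith
    obtain ⟨n, hn⟩ := exists_pnat_eq ha
    refine ⟨[n], by simp, ?_⟩
    ext i j
    fin_cases i <;> fin_cases j <;> simp [wordMat, cfMat, hn, hbc, hd]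
  · obtain ⟨n, B, hB, rfl, hlt⟩ := exists_cfMat_mul_of_mem_Sset hA hd
    have := (one_le_of_mem_Sset hB).2.2
    obtain ⟨l, -, rfl⟩ := ih _ (by omega) hB rfl
    exact ⟨n :: l, by simp, wordMat_cons n l⟩

/-! ### Continued fractions -/

lemma irrational_inv_sub {ξ : ℝ} (hξ : Irrational ξ) (n : ℕ) : Irrational (ξ⁻¹ - (n : ℝ)) :=
  (irrational_inv_iff.2 hξ).sub_natCast n

lemma mem_Ioo_of_floor_eq_zero {ξ : ℝ} (hξ : Irrational ξ) (h : ⌊ξ⌋ = 0) : 0 < ξ ∧ ξ < 1 := by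
  obtain ⟨h1, h2⟩ := Int.floor_eq_zero_iff.1 h
  exact ⟨lt_of_le_of_ne h1 (Ne.symm hξ.ne_zero), h2⟩

lemma cfA_add_two {ξ : ℝ} {n : ℕ} (h0 : ⌊ξ⌋ = 0) (h1 : ⌊ξ⁻¹ - (n : ℝ)⌋ = 0) (j : ℕ) :
    cfA (j + 2) ξ = cfA (j + 1) (ξ⁻¹ - (n : ℝ)) := by
  have h2 : ⌊ξ⁻¹⌋ = n := by
    rw [Int.floor_sub_natCast] at h1
    omega
  simp [cfA, h0, h2]

lemma exists_complete_quotient (l : List ℕ+) : ∀ ξ : ℝ, Irrational ξ → cfA 0 ξ = 0 →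
    (∀ j (h : j < l.length), cfA (j + 1) ξ = ((l[j] : ℕ) : ℤ)) →
    ∃ y r : ℝ, 0 < y ∧ y < 1 ∧ 0 < r ∧
      |ξ * (wordMat l 0 0 : ℝ) - (wordMat l 1 0 : ℝ)| = r * y ∧
      |ξ * (wordMat l 0 1 : ℝ) - (wordMat l 1 1 : ℝ)| = r ∧
      r * ((wordMat l 0 0 : ℝ) + wordMat l 0 1 * y) = 1 ∧
      (wordMat l 1 0 : ℝ) + wordMat l 1 1 * y =
        ξ * ((wordMat l 0 0 : ℝ) + wordMat l 0 1 * y) := by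
  induction l with
  | nil =>
    intro ξ hξ h0 _
    obtain ⟨h1, h2⟩ := mem_Ioo_of_floor_eq_zero hξ h0
    exact ⟨ξ, 1, h1, h2, one_pos, by simp [abs_of_pos h1], by simp, by simp, by simp⟩
  | cons n l ih =>
    intro ξ hξ h0 hl
    obtain ⟨hpos, hlt⟩ := mem_Ioo_of_floor_eq_zero hξ h0
    have h00 : ⌊ξ⌋ = 0 := h0
    have hn : ⌊ξ⁻¹⌋ = ((n : ℕ) : ℤ) := by
      have := hl 0 (by simp)
      simpa [cfA, h00] using this
    have h0' : ⌊ξ⁻¹ - ((n : ℕ) : ℝ)⌋ = 0 := by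
      rw [Int.floor_sub_natCast]
      omega
    obtain ⟨y, r, hy0, hy1, hr, e1, e2, e3, e4⟩ := ih (ξ⁻¹ - ((n : ℕ) : ℝ))
      (irrational_inv_sub hξ n) h0' (fun j hj => by
        rw [← cfA_add_two h00 h0']
        exact hl (j + 1) (by simpa using hj))
    have hne := hpos.ne'
    refine ⟨y, ξ * r, hy0, hy1, by positivity, ?_, ?_, ?_, ?_⟩ <;>
      rw [wordMat_cons, cfMat_mul] <;>
      simp only [Matrix.of_apply, Matrix.cons_val', Matrix.cons_val_zero, Matrix.cons_val_one,
        Matrix.cons_val_fin_one] <;> push_cast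
    · rw [mul_assoc, ← e1, ← abs_of_pos hpos, ← abs_mul, abs_of_pos hpos, ← abs_neg]
      congr 1
      field_simp
      ring
    · rw [← e2, ← abs_of_pos hpos, ← abs_mul, abs_of_pos hpos, ← abs_neg]
      congr 1
      field_simp
      ring
    · rw [← e3]
      field_simp at e4
      linear_combination r * e4
    · field_simp at e4
      linear_combination -e4

lemma xiNorm_wordMat_bounds {ξ : ℝ} (hξ : Irrational ξ) (h0 : cfA 0 ξ = 0) {l : List ℕ+}
    (hne : l ≠ []) (hl : ∀ j (h : j < l.length), cfA (j + 1) ξ = ((l[j] : ℕ) : ℤ)) :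
    2⁻¹ * (mnorm (wordMat l))⁻¹ ≤ xiNorm ξ (wordMat l) ∧
      xiNorm ξ (wordMat l) ≤ (mnorm (wordMat l))⁻¹ := by
  obtain ⟨y, r, hy0, hy1, hr, e1, e2, e3, -⟩ := exists_complete_quotient l ξ hξ h0 hl
  have hS := wordMat_mem_Sset hne
  obtain ⟨⟨h1, -⟩, -⟩ := mem_Sset_iff.1 hS
  obtain ⟨hb, -, ha⟩ := one_le_of_mem_Sset hS
  have h1' : (wordMat l 0 1 : ℝ) ≤ wordMat l 0 0 := by exact_mod_cast h1
  have hb' : (1 : ℝ) ≤ wordMat l 0 1 := by exact_mod_cast hb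
  have ha' : (1 : ℝ) ≤ wordMat l 0 0 := by exact_mod_cast ha
  have hmax : xiNorm ξ (wordMat l) = r := by
    rw [xiNorm, e1, e2]
    exact max_eq_right (by nlinarith)
  rw [hmax, mnorm_eq_of_mem_Sset hS, ← mul_inv]
  generalize (wordMat l 0 1 : ℝ) = b at *
  generalize (wordMat l 0 0 : ℝ) = a at *
  constructor
  · rw [inv_le_iff_one_le_mul₀ (by positivity), ← e3]
    gcongr
    nlinarith
  · rw [eq_inv_of_mul_eq_one_left e3]
    gcongr
    nlinarith

lemma floor_eq_zero_of_approx {x : ℝ} (hx : Irrational x)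
    (H : ∀ ε : ℝ, 0 < ε → ∃ l : List ℕ+, l ≠ [] ∧
      |x * (wordMat l 0 0 : ℝ) - (wordMat l 1 0 : ℝ)| < ε) : ⌊x⌋ = 0 := by
  rw [Int.floor_eq_zero_iff]
  have key : ∀ l : List ℕ+, l ≠ [] → (0 : ℝ) ≤ wordMat l 1 0 ∧
      (wordMat l 1 0 : ℝ) ≤ wordMat l 0 0 ∧ (1 : ℝ) ≤ wordMat l 0 0 := by
    intro l hl
    obtain ⟨⟨-, h, -⟩, -⟩ := mem_Sset_iff.1 (wordMat_mem_Sset hl)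
    obtain ⟨-, hc, ha⟩ := one_le_of_mem_Sset (wordMat_mem_Sset hl)
    refine ⟨by exact_mod_cast (by omega : 0 ≤ wordMat l 1 0), by exact_mod_cast h,
      by exact_mod_cast ha⟩
  constructor
  · by_contra! hneg
    obtain ⟨l, hl, h⟩ := H (-x) (by linarith)
    obtain ⟨h1, h2, h3⟩ := key l hl
    have := (abs_lt.1 h).1
    nlinarith
  · by_contra! hge
    have hgt : 1 < x := lt_of_le_of_ne hge (Ne.symm hx.ne_one)
    obtain ⟨l, hl, h⟩ := H (x - 1) (by linarith)
    obtain ⟨h1, h2, h3⟩ := key l hl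
    have := (abs_lt.1 h).2
    nlinarith

lemma cfA_eq_of_approx (i : ℕ) : ∀ (x : ℝ) (b : ℕ → ℕ+), Irrational x →
    (∀ ε : ℝ, 0 < ε → ∀ m : ℕ, ∃ l : List ℕ+, m ≤ l.length ∧
      (∀ j (h : j < l.length), l[j] = b (j + 1)) ∧
      |x * (wordMat l 0 0 : ℝ) - (wordMat l 1 0 : ℝ)| < ε) →
    cfA 0 x = 0 ∧ cfA (i + 1) x = ((b (i + 1) : ℕ) : ℤ) := by
  have floor_zero : ∀ (x : ℝ) (b : ℕ → ℕ+), Irrational x →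
      (∀ ε : ℝ, 0 < ε → ∀ m : ℕ, ∃ l : List ℕ+, m ≤ l.length ∧
        (∀ j (h : j < l.length), l[j] = b (j + 1)) ∧
        |x * (wordMat l 0 0 : ℝ) - (wordMat l 1 0 : ℝ)| < ε) → ⌊x⌋ = 0 := by
    intro x b hx H
    refine floor_eq_zero_of_approx hx fun ε hε => ?_
    obtain ⟨l, h1, -, h2⟩ := H ε hε 1
    exact ⟨l, List.ne_nil_of_length_pos h1, h2⟩
  have shift : ∀ (x : ℝ) (b : ℕ → ℕ+), Irrational x →
      (∀ ε : ℝ, 0 < ε → ∀ m : ℕ, ∃ l : List ℕ+, m ≤ l.length ∧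
        (∀ j (h : j < l.length), l[j] = b (j + 1)) ∧
        |x * (wordMat l 0 0 : ℝ) - (wordMat l 1 0 : ℝ)| < ε) →
      ∀ ε : ℝ, 0 < ε → ∀ m : ℕ, ∃ l : List ℕ+, m ≤ l.length ∧
        (∀ j (h : j < l.length), l[j] = b (j + 2)) ∧
        |(x⁻¹ - ((b 1 : ℕ) : ℝ)) * (wordMat l 0 0 : ℝ) - (wordMat l 1 0 : ℝ)| < ε := by
    intro x b hx H ε hε m
    have hpos := (mem_Ioo_of_floor_eq_zero hx (floor_zero x b hx H)).1
    obtain ⟨l, h1, h2, h3⟩ := H (x * ε) (by positivity) (m + 1)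
    cases l with
    | nil => simp at h1
    | cons n l =>
      have hn : n = b 1 := h2 0 (by simp)
      refine ⟨l, by simpa using h1, fun j hj => h2 (j + 1) (by simpa using hj), ?_⟩
      rw [wordMat_cons, cfMat_mul, hn] at h3
      simp only [Matrix.of_apply, Matrix.cons_val', Matrix.cons_val_zero, Matrix.cons_val_one,
        Matrix.cons_val_fin_one] at h3
      push_cast at h3
      rw [← mul_lt_mul_iff_right₀ hpos]
      refine lt_of_eq_of_lt ?_ h3
      rw [← abs_of_pos hpos, ← abs_mul, abs_of_pos hpos, ← abs_neg]
      have := hpos.ne'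
      congr 1
      field_simp
      ring
  induction i with
  | zero =>
    intro x b hx H
    have h0 := floor_zero x b hx H
    have h1 := floor_zero _ (fun j => b (j + 1)) (irrational_inv_sub hx (b 1)) (shift x b hx H)
    rw [Int.floor_sub_natCast] at h1
    refine ⟨h0, ?_⟩
    simp only [cfA, h0, Int.cast_zero, sub_zero, zero_add]
    omega
  | succ i ih =>
    intro x b hx H
    have h0 := floor_zero x b hx H
    obtain ⟨h1, h2⟩ := ih _ (fun j => b (j + 1)) (irrational_inv_sub hx (b 1)) (shift x b hx H)
    exact ⟨h0, by rw [cfA_add_two h0 h1, h2]⟩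

/-! ### Admissibility -/

lemma isSymm_iff {R : Type*} {A : Matrix (Fin 2) (Fin 2) R} : A.IsSymm ↔ A 0 1 = A 1 0 := by
  refine ⟨fun h => h.apply 1 0, fun h => Matrix.IsSymm.ext fun i j => ?_⟩
  fin_cases i <;> fin_cases j <;> simp [h]

lemma discr_ne_sq {A : M2} (hA : A ∈ Sset) (m : ℤ) :
    (A 0 0 - A 1 1) ^ 2 + 4 * (A 0 1 * A 1 0) ≠ m ^ 2 := by
  intro h
  obtain ⟨⟨h1, h2, h3, h4, h5⟩, -⟩ := mem_Sset_iff.1 hA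
  obtain ⟨hb, hc, ha⟩ := one_le_of_mem_Sset hA
  have hdet := det_eq_of_mem_Sset hA
  rw [← sq_abs m] at h
  have hm := abs_nonneg m
  set t := A 0 0 + A 1 1 with ht
  have htm : t ^ 2 - 4 * (A 0 0 * A 1 1 - A 0 1 * A 1 0) = |m| ^ 2 := by rw [← h, ht]; ring
  rcases hdet with hd | hd
  · have ht3 : 3 ≤ t := by
      by_contra hlt
      have h11 : A 1 1 ≤ 1 := by omega
      have hbc : 1 ≤ A 0 1 * A 1 0 := by nlinarith
      have : A 1 1 ≠ 0 := by
        intro h0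
        rw [h0] at hd
        linarith
      have h11 : A 1 1 = 1 := by omega
      have h00 : A 0 0 = 1 := by omega
      rw [h00, h11] at hd
      linarith
    rw [hd] at htm
    have : |m| < t := by nlinarith
    nlinarith
  · rw [hd] at htm
    have h1 : t < |m| := by nlinarith
    have h2 : t ≤ 1 := by nlinarith
    have h3 : t = 1 := by omega
    rw [h3] at htm
    have : |m| < 3 := by nlinarith
    interval_cases |m| <;> omega

lemma det_commutator_ne_zero {A B : M2} (hA : A ∈ Sset) (h : A * B ≠ B * A) :
    (A * B - B * A).det ≠ 0 := by
  intro hdet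
  obtain ⟨hb, hc, -⟩ := one_le_of_mem_Sset hA
  set C := A * B - B * A with hC
  have htr : C 1 1 = -C 0 0 := by
    simp only [hC, Matrix.sub_apply, Matrix.mul_apply, Fin.sum_univ_two]
    ring
  have horth : C 0 0 * (A 0 0 - A 1 1) + C 0 1 * A 1 0 + C 1 0 * A 0 1 = 0 := by
    simp only [hC, Matrix.sub_apply, Matrix.mul_apply, Fin.sum_univ_two]
    ring
  rw [Matrix.det_fin_two, htr] at hdet
  by_cases hx : C 0 0 = 0
  · rw [hx] at hdet horth
    have hyz : C 0 1 = 0 ∧ C 1 0 = 0 := by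
      rcases mul_eq_zero.1 (by linarith : C 0 1 * C 1 0 = 0) with h0 | h0
      · refine ⟨h0, ?_⟩
        rw [h0] at horth
        have : C 1 0 * A 0 1 = 0 := by linarith
        exact (mul_eq_zero.1 this).resolve_right (by omega)
      · refine ⟨?_, h0⟩
        rw [h0] at horth
        have : C 0 1 * A 1 0 = 0 := by linarith
        exact (mul_eq_zero.1 this).resolve_right (by omega)
    apply h
    rw [← sub_eq_zero, ← hC]
    ext i j
    fin_cases i <;> fin_cases j <;> simp [hx, hyz, htr]
  · have hk : C 0 0 ^ 2 * ((A 0 0 - A 1 1) ^ 2 + 4 * (A 0 1 * A 1 0)) =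
        (C 0 1 * A 1 0 - C 1 0 * A 0 1) ^ 2 := by
      linear_combination (C 0 0 * (A 0 0 - A 1 1) - (C 0 1 * A 1 0 + C 1 0 * A 0 1)) * horth -
        4 * A 0 1 * A 1 0 * hdet
    obtain ⟨m, hm⟩ := (Int.pow_dvd_pow_iff two_ne_zero).1 (Dvd.intro _ hk)
    rw [hm, mul_pow] at hk
    exact discr_ne_sq hA m (mul_left_cancel₀ (pow_ne_zero 2 hx) hk)

lemma isSymm_of_smul {k : ℤ} (hk : k ≠ 0) {A : M2} (h : (k • A).IsSymm) : A.IsSymm := by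
  rw [isSymm_iff] at *
  simpa [hk] using h

lemma exists_symmetrizer {A B : M2} (hA : A.det ≠ 0) (hB : B.det ≠ 0)
    (hcomm : (A * B - B * A).det ≠ 0)    (htr : A 0 0 + A 1 1 ≠ 0) :
    ∃ N : M2, MemP N ∧ N ≠ Nᵀ ∧ N ≠ -Nᵀ ∧ (A * Nᵀ).IsSymm ∧ (B * N).IsSymm ∧
      (B * A * Nᵀ).IsSymm := by
  set N₀ : M2 := B.adjugate * (A * B - B * A) * A * !![0, 1; -1, 0] with hN₀
  have hanti : N₀ 0 1 - N₀ 1 0 = (A * B - B * A).det := by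
    simp only [hN₀, Matrix.adjugate_fin_two, Matrix.det_fin_two, Matrix.sub_apply,
      Matrix.mul_apply, Fin.sum_univ_two, Matrix.of_apply, Matrix.cons_val', Matrix.cons_val_zero,
      Matrix.cons_val_one, Matrix.cons_val_fin_one]
    ring
  have hdet : N₀.det = B.det * A.det * (A * B - B * A).det := by
    rw [hN₀, Matrix.det_mul, Matrix.det_mul, Matrix.det_mul, Matrix.det_adjugate]
    simp
    ring
  have h1 : (A * N₀ᵀ).IsSymm := by
    rw [isSymm_iff]
    simp only [hN₀, Matrix.adjugate_fin_two, Matrix.sub_apply, Matrix.transpose_apply,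
      Matrix.mul_apply, Fin.sum_univ_two, Matrix.of_apply, Matrix.cons_val', Matrix.cons_val_zero,
      Matrix.cons_val_one, Matrix.cons_val_fin_one]
    ring
  have h2 : (B * N₀).IsSymm := by
    rw [isSymm_iff]
    simp only [hN₀, Matrix.adjugate_fin_two, Matrix.sub_apply, Matrix.mul_apply,
      Fin.sum_univ_two, Matrix.of_apply, Matrix.cons_val', Matrix.cons_val_zero,
      Matrix.cons_val_one, Matrix.cons_val_fin_one]
    ring
  have h3 : (B * A * N₀ᵀ).IsSymm := by
    rw [isSymm_iff]
    simp only [hN₀, Matrix.adjugate_fin_two, Matrix.sub_apply, Matrix.transpose_apply,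
      Matrix.mul_apply, Fin.sum_univ_two, Matrix.of_apply, Matrix.cons_val', Matrix.cons_val_zero,
      Matrix.cons_val_one, Matrix.cons_val_fin_one]
    ring
  have hdet0 : N₀.det ≠ 0 := by
    rw [hdet]
    exact mul_ne_zero (mul_ne_zero hB hA) hcomm
  have hc : (content N₀ : ℤ) ≠ 0 := by exact_mod_cast (content_pos hdet0).ne'
  have hred := content_smul_red N₀
  generalize N₀ = N at *
  set R := red N
  have hT : (content N : ℤ) • Rᵀ = Nᵀ := by rw [← Matrix.transpose_smul, hred]
  have hR1 : (A * Rᵀ).IsSymm :=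
    isSymm_of_smul hc (by rwa [← Matrix.mul_smul, hT])
  have hR2 : (B * R).IsSymm :=
    isSymm_of_smul hc (by rwa [← Matrix.mul_smul, hred])
  have hR3 : (B * A * Rᵀ).IsSymm :=
    isSymm_of_smul hc (by rwa [← Matrix.mul_smul, hT])
  have hanti' : R 0 1 - R 1 0 ≠ 0 := by
    intro h
    apply hcomm
    rw [← hanti, ← hred, Matrix.smul_apply, Matrix.smul_apply, ← smul_sub, h, smul_zero]
  have hdetR : R.det ≠ 0 := by
    intro h
    apply hdet0
    rw [← hred, Matrix.det_smul, h, mul_zero]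
  refine ⟨R, ⟨primitive_red hdet0, hdetR⟩, fun h => ?_, fun h => ?_, hR1, hR2, hR3⟩
  · have := congrFun (congrFun h 0) 1
    rw [Matrix.transpose_apply] at this
    exact hanti' (sub_eq_zero.2 this)
  · have e00 := congrFun (congrFun h 0) 0
    have e01 := congrFun (congrFun h 0) 1
    have e11 := congrFun (congrFun h 1) 1
    simp only [Matrix.neg_apply, Matrix.transpose_apply] at e00 e01 e11
    have e00 : R 0 0 = 0 := by omega
    have e11 : R 1 1 = 0 := by omega
    rw [isSymm_iff] at hR1
    simp only [Matrix.mul_apply, Fin.sum_univ_two, Matrix.transpose_apply, e00, e11, e01] at hR1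
    have : (A 0 0 + A 1 1) * R 1 0 = 0 := by linarith
    rcases mul_eq_zero.1 this with h' | h'
    · exact htr h'
    · apply hanti'
      rw [e01, h']
      rfl

lemma isSymm_fib_step {V W P : M2} (h1 : (V * Pᵀ).IsSymm) (h2 : (W * P).IsSymm) :
    (W * V * W * P).IsSymm := by
  have h : W * V * W * P = W * (V * Pᵀ) * Wᵀ := by
    have h2' : W * P = Pᵀ * Wᵀ := by rw [← h2.eq, Matrix.transpose_mul]
    rw [Matrix.mul_assoc (W * V), h2', Matrix.mul_assoc W, Matrix.mul_assoc W, Matrix.mul_assoc V]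
  rw [h, Matrix.IsSymm, Matrix.transpose_mul, Matrix.transpose_mul, h1.eq,
    Matrix.transpose_transpose, ← Matrix.mul_assoc]

/-- The determinant of the coordinates of three symmetric matrices. -/
def symmDet (X Y Z : M2) : ℤ :=
  X 0 0 * (Y 0 1 * Z 1 1 - Y 1 1 * Z 0 1) - X 0 1 * (Y 0 0 * Z 1 1 - Y 1 1 * Z 0 0) +
    X 1 1 * (Y 0 0 * Z 0 1 - Y 0 1 * Z 0 0)

lemma trace_eq_neg_symmDet {X Y Z : M2} (hX : X.IsSymm) (hY : Y.IsSymm) (hZ : Z.IsSymm) :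
    (Z * !![0, 1; -1, 0] * X * !![0, 1; -1, 0] * Y * !![0, 1; -1, 0]).trace =
      -symmDet X Y Z := by
  rw [isSymm_iff] at hX hY hZ
  simp [Matrix.trace_fin_two, Matrix.mul_apply, Fin.sum_univ_two, symmDet, ← hX, ← hY, ← hZ]
  ring

lemma mul_skew_mul_transpose (A : M2) :
    A * !![0, 1; -1, 0] * Aᵀ = A.det • !![0, 1; -1, 0] := by
  ext i j
  fin_cases i <;> fin_cases j <;>
    simp [Matrix.mul_apply, Fin.sum_univ_two, Matrix.det_fin_two] <;> ring

lemma symmDet_fib {V W P : M2} (h1 : (V * Pᵀ).IsSymm) (h2 : (W * P).IsSymm)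
    (h3 : (W * V * Pᵀ).IsSymm) :
    symmDet (V * Pᵀ) (W * P) (W * V * Pᵀ) =
      P.det * V.det * W.det * (P 0 1 - P 1 0) := by
  rw [← neg_inj, ← trace_eq_neg_symmDet h1 h2 h3]
  set J : M2 := !![0, 1; -1, 0] with hJ
  have hJJ : J * J = -1 := by
    ext i j
    fin_cases i <;> fin_cases j <;> simp [hJ]
  have e1 : V * Pᵀ = P * Vᵀ := by
    rw [← h1.eq, Matrix.transpose_mul, Matrix.transpose_transpose]
  have e2 : W * P = Pᵀ * Wᵀ := by rw [← h2.eq, Matrix.transpose_mul]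
  have hP : Pᵀ * J * P = P.det • J := by
    simpa only [Matrix.transpose_transpose, Matrix.det_transpose] using mul_skew_mul_transpose Pᵀ
  have hW : Wᵀ * J * W = W.det • J := by
    simpa only [Matrix.transpose_transpose, Matrix.det_transpose] using mul_skew_mul_transpose Wᵀ
  calc (W * V * Pᵀ * J * (V * Pᵀ) * J * (W * P) * J).trace
      = (W * V * (Pᵀ * J * P) * Vᵀ * J * Pᵀ * Wᵀ * J).trace := by
        rw [e1, e2]
        simp only [Matrix.mul_assoc]
    _ = P.det * (W * (V * J * Vᵀ) * J * Pᵀ * Wᵀ * J).trace := by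
        rw [hP]
        simp only [Matrix.mul_assoc, Matrix.smul_mul, Matrix.mul_smul, Matrix.trace_smul,
          smul_eq_mul]
    _ = P.det * V.det * (W * (J * J) * Pᵀ * Wᵀ * J).trace := by
        rw [mul_skew_mul_transpose, ← hJ]
        simp only [Matrix.smul_mul, Matrix.mul_smul, Matrix.trace_smul, smul_eq_mul, mul_assoc]
    _ = -(P.det * V.det * (W * (Pᵀ * Wᵀ * J)).trace) := by
        rw [hJJ]
        simp [Matrix.mul_assoc]
    _ = -(P.det * V.det * (Pᵀ * (Wᵀ * J * W)).trace) := by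
        rw [Matrix.trace_mul_comm]
        simp only [Matrix.mul_assoc]
    _ = -(P.det * V.det * W.det * (P 0 1 - P 1 0)) := by
        rw [hW]
        simp [Matrix.trace_fin_two, hJ, Matrix.mul_apply, Fin.sum_univ_two]
        ring

/-! ### Norms -/

lemma abs_apply_le_mnorm (A : M2) (i j : Fin 2) : |(A i j : ℝ)| ≤ mnorm A := by
  fin_cases i <;> fin_cases j <;> simp [mnorm]

lemma mnorm_nonneg (A : M2) : 0 ≤ mnorm A := (abs_nonneg _).trans (abs_apply_le_mnorm A 0 0)

lemma mnorm_le_iff {A : M2} {c : ℝ} : mnorm A ≤ c ↔ ∀ i j, |(A i j : ℝ)| ≤ c := by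
  refine ⟨fun h i j => (abs_apply_le_mnorm A i j).trans h, fun h => ?_⟩
  exact max_le (max_le (h _ _) (h _ _)) (max_le (h _ _) (h _ _))

lemma mnorm_transpose (A : M2) : mnorm Aᵀ = mnorm A :=
  le_antisymm (mnorm_le_iff.2 fun i j => abs_apply_le_mnorm A j i)
    (mnorm_le_iff.2 fun i j => abs_apply_le_mnorm Aᵀ j i)

lemma mnorm_pos {A : M2} (hA : A.det ≠ 0) : 0 < mnorm A := by
  refine lt_of_le_of_ne (mnorm_nonneg A) fun h => hA ?_
  have : A = 0 := by
    ext i j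
    have := abs_apply_le_mnorm A i j
    rw [← h] at this
    simpa using abs_nonpos_iff.1 this
  rw [this]
  simp

lemma xiNorm_nonneg (ξ : ℝ) (A : M2) : 0 ≤ xiNorm ξ A := (abs_nonneg _).trans (le_max_left _ _)

lemma abs_mul_add_mul_le {x y u v c d : ℝ} (hx : |x| ≤ c) (hy : |y| ≤ c) (hu : |u| ≤ d)
    (hv : |v| ≤ d) : |x * u + y * v| ≤ 2 * c * d := by
  have hc := (abs_nonneg _).trans hx
  calc |x * u + y * v| ≤ |x| * |u| + |y| * |v| := by
        rw [← abs_mul, ← abs_mul]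
        exact abs_add_le _ _
    _ ≤ c * d + c * d := by gcongr
    _ = 2 * c * d := by ring

lemma mnorm_mul_le (A B : M2) : mnorm (A * B) ≤ 2 * mnorm A * mnorm B := by
  refine mnorm_le_iff.2 fun i j => ?_
  rw [Matrix.mul_apply, Fin.sum_univ_two]
  push_cast
  exact abs_mul_add_mul_le (abs_apply_le_mnorm _ _ _) (abs_apply_le_mnorm _ _ _)
    (abs_apply_le_mnorm _ _ _) (abs_apply_le_mnorm _ _ _)

lemma xiNorm_mul_le (ξ : ℝ) (A B : M2) : xiNorm ξ (A * B) ≤ 2 * xiNorm ξ A * mnorm B := by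
  have key : ∀ j, |ξ * ((A * B) 0 j : ℝ) - ((A * B) 1 j : ℝ)| ≤ 2 * xiNorm ξ A * mnorm B := by
    intro j
    have : ξ * ((A * B) 0 j : ℝ) - ((A * B) 1 j : ℝ) =
        (ξ * A 0 0 - A 1 0) * B 0 j + (ξ * A 0 1 - A 1 1) * B 1 j := by
      simp only [Matrix.mul_apply, Fin.sum_univ_two]
      push_cast
      ring
    rw [this]
    exact abs_mul_add_mul_le (le_max_left _ _) (le_max_right _ _)
      (abs_apply_le_mnorm _ _ _) (abs_apply_le_mnorm _ _ _)
  exact max_le (key 0) (key 1)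

lemma one_le_mnorm {A : M2} (hA : A ∈ Sset) : 1 ≤ mnorm A := by
  rw [mnorm_eq_of_mem_Sset hA]
  exact_mod_cast (one_le_of_mem_Sset hA).2.2

/-! ### Growth of Fibonacci sequences -/

lemma gam_sq : gam ^ 2 = gam + 1 := Real.goldenRatio_sq

lemma one_lt_gam : 1 < gam := Real.one_lt_goldenRatio

lemma gam_lt_two : gam < 2 := Real.goldenRatio_lt_two

lemma exists_abs_sub_gam_mul_le {L : ℕ → ℝ} {c : ℝ}
    (h0 : ∀ i, 1 ≤ i → L (i + 1) + L i ≤ L (i + 2))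
    (h1 : ∀ i, 1 ≤ i → L (i + 2) ≤ c + (L (i + 1) + L i)) :
    ∃ K : ℝ, ∀ i, 1 ≤ i → |L (i + 1) - gam * L i| ≤ K := by
  have hg := gam_sq
  have hg1 := one_lt_gam
  have hg2 := gam_lt_two
  have hc : 0 ≤ c := by linarith [h0 1 le_rfl, h1 1 le_rfl]
  set K := |L 2 - gam * L 1| + c / (2 - gam) with hK
  have hcK : c ≤ (2 - gam) * K := by
    have : 0 < 2 - gam := by linarith
    rw [hK, mul_add, mul_div_cancel₀ _ this.ne']
    have := mul_nonneg this.le (abs_nonneg (L 2 - gam * L 1))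
    linarith
  refine ⟨K, fun i hi => ?_⟩
  induction i, hi using Nat.le_induction with
  | base =>
    have : 0 ≤ c / (2 - gam) := div_nonneg hc (by linarith)
    rw [hK]
    linarith
  | succ i hi ih =>
    have e0 := h0 i hi
    have e1 := h1 i hi
    have : L (i + 1 + 1) - gam * L (i + 1) =
        -(gam - 1) * (L (i + 1) - gam * L i) + (L (i + 2) - (L (i + 1) + L i)) := by
      linear_combination (-L i) * hg
    rw [this]
    rw [abs_le] at ih ⊢
    constructor <;> nlinarith

lemma exists_norm_bounds {W : ℕ → M2} (hS : ∀ i, 1 ≤ i → W i ∈ Sset)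
    (hfib : ∀ i, 1 ≤ i → W (i + 2) = W (i + 1) * W i) :
    ∃ c₁ c₂ : ℝ, 0 < c₁ ∧ 0 < c₂ ∧ ∀ i, 1 ≤ i → c₁ * mnorm (W i) ^ gam ≤ mnorm (W (i + 1)) ∧
      mnorm (W (i + 1)) ≤ c₂ * mnorm (W i) ^ gam := by
  have hpos : ∀ i, 1 ≤ i → 0 < mnorm (W i) := fun i hi =>
    one_pos.trans_le (one_le_mnorm (hS i hi))
  have hmul : ∀ i, 1 ≤ i → mnorm (W (i + 1)) * mnorm (W i) ≤ mnorm (W (i + 2)) ∧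
      mnorm (W (i + 2)) ≤ 2 * (mnorm (W (i + 1)) * mnorm (W i)) := by
    intro i hi
    have hb := mul_apply_zero_zero_bounds (hS (i + 1) (by omega)) (hS i hi)
    rw [← hfib i hi] at hb
    rw [mnorm_eq_of_mem_Sset (hS _ hi), mnorm_eq_of_mem_Sset (hS (i + 1) (by omega)),
      mnorm_eq_of_mem_Sset (hS (i + 2) (by omega))]
    exact ⟨by exact_mod_cast hb.1.le, by exact_mod_cast hb.2⟩
  obtain ⟨K, hK⟩ := exists_abs_sub_gam_mul_le (L := fun i => Real.log (mnorm (W i)))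
    (c := Real.log 2)
    (fun i hi => by
      have h1 := hpos i hi
      have h2 := hpos (i + 1) (by omega)
      rw [← Real.log_mul h2.ne' h1.ne']
      exact Real.log_le_log (mul_pos h2 h1) (hmul i hi).1)
    (fun i hi => by
      have h1 := hpos i hi
      have h2 := hpos (i + 1) (by omega)
      rw [← Real.log_mul h2.ne' h1.ne', ← Real.log_mul two_ne_zero (mul_pos h2 h1).ne']
      exact Real.log_le_log (hpos (i + 2) (by omega)) (hmul i hi).2)
  refine ⟨Real.exp (-K), Real.exp K, Real.exp_pos _, Real.exp_pos _, fun i hi => ?_⟩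
  have h := abs_le.1 (hK i hi)
  have h2 := hpos (i + 1) (by omega)
  rw [Real.rpow_def_of_pos (hpos i hi), ← Real.exp_add, ← Real.exp_add,
    ← Real.le_log_iff_exp_le h2, ← Real.log_le_iff_le_exp h2]
  constructor <;> linarith

lemma natCast_le_mnorm {W : ℕ → M2} (hS : ∀ i, 1 ≤ i → W i ∈ Sset)
    (hfib : ∀ i, 1 ≤ i → W (i + 2) = W (i + 1) * W i) (i : ℕ) : (i : ℝ) ≤ mnorm (W (i + 1)) := by
  rw [mnorm_eq_of_mem_Sset (hS _ (by omega))]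
  suffices H : (i : ℤ) ≤ W (i + 1) 0 0 by exact_mod_cast H
  induction i with
  | zero => exact_mod_cast zero_le_one.trans (one_le_of_mem_Sset (hS 1 le_rfl)).2.2
  | succ i ih =>
    rcases Nat.eq_zero_or_pos i with rfl | hi
    · exact (one_le_of_mem_Sset (hS 2 (by omega))).2.2
    · have h1 := (mul_apply_zero_zero_bounds (hS (i + 1) (by omega)) (hS i hi)).1
      have h2 := (one_le_of_mem_Sset (hS i hi)).2.2
      have h3 := (one_le_of_mem_Sset (hS (i + 1) (by omega))).2.2
      rw [← hfib i hi] at h1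
      push_cast
      have : W (i + 1) 0 0 ≤ W (i + 1) 0 0 * W i 0 0 := le_mul_of_one_le_right (by omega) h2
      change (i : ℤ) + 1 ≤ W (i + 2) 0 0
      omega

/-! ### Extremality -/

lemma symm_approx {ξ : ℝ} {X : M2} (hX : X.IsSymm) :
    |(X 0 0 : ℝ) * ξ - X 0 1| ≤ (|ξ| + 1) * xiNorm ξ X ∧
      |(X 0 0 : ℝ) * ξ ^ 2 - X 1 1| ≤ (|ξ| + 1) * xiNorm ξ X := by
  rw [isSymm_iff] at hX
  have h0 : |ξ * (X 0 0 : ℝ) - X 1 0| ≤ xiNorm ξ X := le_max_left _ _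
  have h1 : |ξ * (X 0 1 : ℝ) - X 1 1| ≤ xiNorm ξ X := le_max_right _ _
  have hn := xiNorm_nonneg ξ X
  have hx := mul_nonneg (abs_nonneg ξ) hn
  constructor
  · rw [hX, mul_comm]
    linarith
  · have : (X 0 0 : ℝ) * ξ ^ 2 - X 1 1 =
        ξ * (ξ * X 0 0 - X 1 0) + (ξ * X 0 1 - X 1 1) := by rw [hX]; ring
    rw [this]
    refine (abs_add_le _ _).trans ?_
    rw [abs_mul, add_mul, one_mul]
    gcongr

lemma eq_zero_of_symmDet_ne_zero {X Y Z : M2} (h : symmDet X Y Z ≠ 0) {a b c : ℤ}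
    (hX : a * X 1 1 + b * X 0 1 + c * X 0 0 = 0) (hY : a * Y 1 1 + b * Y 0 1 + c * Y 0 0 = 0)
    (hZ : a * Z 1 1 + b * Z 0 1 + c * Z 0 0 = 0) : a = 0 ∧ b = 0 ∧ c = 0 := by
  refine ⟨?_, ?_, ?_⟩ <;> refine (mul_eq_zero.1 ?_).resolve_left h <;> rw [symmDet]
  · linear_combination (Y 0 0 * Z 0 1 - Y 0 1 * Z 0 0) * hX -
      (X 0 0 * Z 0 1 - X 0 1 * Z 0 0) * hY + (X 0 0 * Y 0 1 - X 0 1 * Y 0 0) * hZ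
  · linear_combination -(Y 0 0 * Z 1 1 - Y 1 1 * Z 0 0) * hX +
      (X 0 0 * Z 1 1 - X 1 1 * Z 0 0) * hY - (X 0 0 * Y 1 1 - X 1 1 * Y 0 0) * hZ
  · linear_combination (Y 0 1 * Z 1 1 - Y 1 1 * Z 0 1) * hX -
      (X 0 1 * Z 1 1 - X 1 1 * Z 0 1) * hY + (X 0 1 * Y 1 1 - X 1 1 * Y 0 1) * hZ

lemma rat_quadratic_ne_zero {ξ : ℝ}
    (H : ∀ a b c : ℤ, (a : ℝ) * ξ ^ 2 + b * ξ + c = 0 → a = 0 ∧ b = 0 ∧ c = 0) (a b c : ℚ)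
    (hne : ¬(a = 0 ∧ b = 0 ∧ c = 0)) : (a : ℝ) * ξ ^ 2 + (b : ℝ) * ξ + (c : ℝ) ≠ 0 := by
  intro h
  apply hne
  have ha : (a.den : ℝ) ≠ 0 := by exact_mod_cast a.den_nz
  have hb : (b.den : ℝ) ≠ 0 := by exact_mod_cast b.den_nz
  have hc : (c.den : ℝ) ≠ 0 := by exact_mod_cast c.den_nz
  obtain ⟨h1, h2, h3⟩ := H (a.num * b.den * c.den) (b.num * a.den * c.den)
    (c.num * a.den * b.den) (by
      rw [Rat.cast_def a, Rat.cast_def b, Rat.cast_def c] at h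
      field_simp at h
      push_cast
      linear_combination h)
  simpa using And.intro h1 (And.intro h2 h3)

theorem isExtremal_of_isAssociated {ξ : ℝ} {W : ℕ → M2} (hS : ∀ i, 1 ≤ i → W i ∈ Sset)
    (hfib : ∀ i, 1 ≤ i → W (i + 2) = W (i + 1) * W i) (hW : IsAssociated ξ W) :
    IsExtremal ξ := by
  obtain ⟨-, -, ⟨N, ⟨-, hN0⟩, hNs, -, hN⟩, c₁, c₂, c₃, c₄, c₅, c₆, -, hc2, -, hc4, -, -, hc⟩ := hW
  set P : ℕ → M2 := fun i => if i % 2 = 1 then Nᵀ else N with hP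
  have hPsucc : ∀ i, P (i + 1) = (P i)ᵀ := by
    intro i
    rcases Nat.mod_two_eq_zero_or_one i with h | h
    · simp [hP, h, Nat.add_mod]
    · simp [hP, h, Nat.add_mod]
  have hPdet : ∀ i, (P i).det ≠ 0 := by
    intro i
    simp only [hP]
    split_ifs <;> simpa using hN0
  have hPanti : ∀ i, P i 0 1 - P i 1 0 ≠ 0 := by
    have : N 0 1 - N 1 0 ≠ 0 := fun h => hNs (isSymm_iff.2 (sub_eq_zero.1 h)).eq.symm
    intro i
    simp only [hP]
    split_ifs
    · rw [Matrix.transpose_apply, Matrix.transpose_apply]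
      omega
    · exact this
  have hPnorm : ∀ i, mnorm (P i) = mnorm N := by
    intro i
    simp only [hP]
    split_ifs
    · exact mnorm_transpose N
    · rfl
  have hNpos := mnorm_pos hN0
  have hWpos : ∀ i, 1 ≤ i → 0 < mnorm (W i) := fun i hi =>
    one_pos.trans_le (one_le_mnorm (hS i hi))
  set κ := (|ξ| + 1) * (2 * c₄ * mnorm N) with hκ
  have hκ0 : 0 < κ := by positivity
  have happrox : ∀ i, 1 ≤ i →
      |((W i * P i) 0 0 : ℝ) * ξ - (W i * P i) 0 1| ≤ κ * (mnorm (W i))⁻¹ ∧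
      |((W i * P i) 0 0 : ℝ) * ξ ^ 2 - (W i * P i) 1 1| ≤ κ * (mnorm (W i))⁻¹ := by
    intro i hi
    have hle : (|ξ| + 1) * xiNorm ξ (W i * P i) ≤ κ * (mnorm (W i))⁻¹ := by
      have h1 := xiNorm_mul_le ξ (W i) (P i)
      have h2 := (hc i hi).2.2.2.1
      rw [hPnorm] at h1
      calc (|ξ| + 1) * xiNorm ξ (W i * P i)
          ≤ (|ξ| + 1) * (2 * (c₄ * (mnorm (W i))⁻¹) * mnorm N) := by
            gcongr
            exact h1.trans (by gcongr)
        _ = κ * (mnorm (W i))⁻¹ := by rw [hκ]; ring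
    obtain ⟨h1, h2⟩ := symm_approx (ξ := ξ) (hN i hi)
    exact ⟨h1.trans hle, h2.trans hle⟩
  constructor
  · refine rat_quadratic_ne_zero fun a b c habc => ?_
    obtain ⟨n, hn⟩ := exists_nat_gt ((|(a : ℝ)| + |(b : ℝ)|) * κ)
    have hzero : ∀ i, n ≤ i →
        a * (W (i + 1) * P (i + 1)) 1 1 + b * (W (i + 1) * P (i + 1)) 0 1 +
          c * (W (i + 1) * P (i + 1)) 0 0 = 0 := by
      intro i hi
      obtain ⟨h1, h2⟩ := happrox (i + 1) (by omega)
      have hbig : (|(a : ℝ)| + |(b : ℝ)|) * κ < mnorm (W (i + 1)) :=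
        (hn.trans_le (by exact_mod_cast hi)).trans_le (natCast_le_mnorm hS hfib i)
      have hw := hWpos (i + 1) (by omega)
      generalize W (i + 1) * P (i + 1) = X at *
      rw [← Int.abs_lt_one_iff]
      have hk : ((a * X 1 1 + b * X 0 1 + c * X 0 0 : ℤ) : ℝ) =
          -(a * ((X 0 0 : ℝ) * ξ ^ 2 - X 1 1) + b * ((X 0 0 : ℝ) * ξ - X 0 1)) := by
        push_cast
        linear_combination (X 0 0 : ℝ) * habc
      have hlt : |((a * X 1 1 + b * X 0 1 + c * X 0 0 : ℤ) : ℝ)| < 1 := by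
        rw [hk, abs_neg]
        calc |(a : ℝ) * ((X 0 0 : ℝ) * ξ ^ 2 - X 1 1) + b * ((X 0 0 : ℝ) * ξ - X 0 1)|
            ≤ |(a : ℝ)| * |(X 0 0 : ℝ) * ξ ^ 2 - X 1 1| + |(b : ℝ)| * |(X 0 0 : ℝ) * ξ - X 0 1| := by
              rw [← abs_mul, ← abs_mul]
              exact abs_add_le _ _
          _ ≤ |(a : ℝ)| * (κ * (mnorm (W (i + 1)))⁻¹) + |(b : ℝ)| * (κ * (mnorm (W (i + 1)))⁻¹) := by
              gcongr
          _ = ((|(a : ℝ)| + |(b : ℝ)|) * κ) / mnorm (W (i + 1)) := by ring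
          _ < 1 := (div_lt_one hw).2 hbig
      exact_mod_cast hlt
    have hsymm1 := hN (n + 1) (by omega)
    have hsymm2 := hN (n + 2) (by omega)
    have hsymm3 := hN (n + 3) (by omega)
    have e1 : P (n + 1) = (P (n + 2))ᵀ := by rw [hPsucc (n + 1), Matrix.transpose_transpose]
    have e3 : P (n + 3) = (P (n + 2))ᵀ := hPsucc (n + 2)
    have eW : W (n + 3) = W (n + 2) * W (n + 1) := hfib (n + 1) (by omega)
    have hdet : ∀ i, 1 ≤ i → (W i).det ≠ 0 := fun i hi =>
      (memP_of_inGL2Z (mem_Sset_iff.1 (hS i hi)).2).2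
    have z1 := hzero n le_rfl
    have z2 := hzero (n + 1) (by omega)
    have z3 := hzero (n + 2) (by omega)
    change (W (n + 1) * P (n + 1)).IsSymm at hsymm1
    change (W (n + 2) * P (n + 2)).IsSymm at hsymm2
    change (W (n + 3) * P (n + 3)).IsSymm at hsymm3
    rw [e1] at hsymm1 z1
    rw [e3, eW] at hsymm3 z3
    refine eq_zero_of_symmDet_ne_zero ?_ z1 z2 z3
    change symmDet _ (W (n + 2) * P (n + 2)) _ ≠ 0
    rw [symmDet_fib hsymm1 hsymm2 hsymm3]
    exact mul_ne_zero (mul_ne_zero (mul_ne_zero (hPdet _) (hdet _ (by omega)))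
      (hdet _ (by omega))) (hPanti _)
  · have hg : 0 < gam := one_pos.trans one_lt_gam
    set q : ℕ → ℝ := fun i => 2 * mnorm (W i) * mnorm N with hq
    have hqpos : ∀ i, 1 ≤ i → 0 < q i := fun i hi => by
      have := hWpos i hi
      positivity
    set s := (2 * mnorm N * c₂) ^ (1 / gam) with hs
    have hspos : 0 < s := by positivity
    have hq1 : 0 < q 1 ^ (1 / gam) := Real.rpow_pos_of_pos (hqpos 1 le_rfl) _
    refine ⟨q 1 ^ (1 / gam) + κ * s, by positivity, fun X hX => ?_⟩
    have hX0 : 0 < X := by linarith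
    have hXg : 0 < X ^ (1 / gam) := Real.rpow_pos_of_pos hX0 _
    have hXinv : X ^ (-1 / gam) = (X ^ (1 / gam))⁻¹ := by
      rw [← Real.rpow_neg hX0.le, neg_div]
    have hexp : 0 ≤ 1 / gam := by positivity
    rw [hXinv]
    rcases lt_or_ge X (q 1) with hlt | hge
    · refine ⟨0, 0, 1, by simp, by simpa using hX0.le, ?_, ?_⟩
      · rw [Int.cast_zero, zero_mul, sub_zero, abs_zero]
        exact mul_nonneg (add_pos hq1 (mul_pos hκ0 hspos)).le (inv_pos.2 hXg).le
      have : X ^ (1 / gam) ≤ q 1 ^ (1 / gam) := Real.rpow_le_rpow hX0.le hlt.le hexp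
      simp only [Int.cast_zero, zero_mul, Int.cast_one, zero_sub, abs_neg, abs_one]
      rw [← div_eq_mul_inv, one_le_div hXg]
      have := mul_pos hκ0 hspos
      linarith
    · have hex : ∃ n, 1 ≤ n ∧ X < q n := by
        obtain ⟨n, hn⟩ := exists_nat_gt (X / (2 * mnorm N))
        refine ⟨n + 1, by omega, ?_⟩
        have h1 := hn.trans_le (natCast_le_mnorm hS hfib n)
        rw [div_lt_iff₀ (by positivity)] at h1
        simp only [hq]
        linarith
      obtain ⟨hn1, hn2⟩ := Nat.find_spec hex
      set n := Nat.find hex with hndef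
      have hn : n ≠ 1 := by
        intro h
        rw [h] at hn2
        linarith
      obtain ⟨i, hi⟩ : ∃ i, n = i + 1 := ⟨n - 1, by omega⟩
      have hi1 : 1 ≤ i := by omega
      have hqi : q i ≤ X := by
        by_contra! hlt
        exact Nat.find_min hex (by omega : i < n) ⟨hi1, hlt⟩
      rw [hi] at hn2
      have hwi := hWpos i hi1
      have hinv : (mnorm (W i))⁻¹ ≤ s * (X ^ (1 / gam))⁻¹ := by
        rw [← div_eq_mul_inv, le_div_iff₀ hXg, inv_mul_le_iff₀ hwi]
        have hXle : X ≤ mnorm (W i) ^ gam * (2 * mnorm N * c₂) := by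
          have h1 := (hc i hi1).2.1
          calc X ≤ 2 * mnorm (W (i + 1)) * mnorm N := hn2.le
            _ ≤ 2 * (c₂ * mnorm (W i) ^ gam) * mnorm N := by gcongr
            _ = _ := by ring
        calc X ^ (1 / gam) ≤ (mnorm (W i) ^ gam * (2 * mnorm N * c₂)) ^ (1 / gam) :=
              Real.rpow_le_rpow hX0.le hXle hexp
          _ = mnorm (W i) * s := by
              rw [Real.mul_rpow (by positivity) (by positivity), ← Real.rpow_mul hwi.le,
                mul_one_div_cancel hg.ne', Real.rpow_one]
      have hbound : κ * (mnorm (W i))⁻¹ ≤ (q 1 ^ (1 / gam) + κ * s) * (X ^ (1 / gam))⁻¹ := by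
        calc κ * (mnorm (W i))⁻¹ ≤ κ * (s * (X ^ (1 / gam))⁻¹) := by gcongr
          _ = (κ * s) * (X ^ (1 / gam))⁻¹ := by ring
          _ ≤ _ := by
              gcongr
              linarith
      obtain ⟨h1, h2⟩ := happrox i hi1
      refine ⟨(W i * P i) 0 0, (W i * P i) 0 1, (W i * P i) 1 1, ?_, ?_, h1.trans hbound,
        h2.trans hbound⟩
      · rintro ⟨h00, h01, -⟩
        have hd : (W i * P i).det ≠ 0 := by
          rw [Matrix.det_mul]
          exact mul_ne_zero (memP_of_inGL2Z (mem_Sset_iff.1 (hS i hi1)).2).2 (hPdet i)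
        rw [Matrix.det_fin_two, h00, h01] at hd
        simp at hd
      · refine (abs_apply_le_mnorm _ 0 0).trans ((mnorm_mul_le _ _).trans ?_)
        rw [hPnorm]
        exact hqi

/-! ### Fibonacci sequences of words -/

section FibWords

variable {α : Type} {w : ℕ → List α}

lemma FibWordSeq.ne_nil (hw : FibWordSeq w) (h1 : w 1 ≠ []) (h2 : w 2 ≠ []) :
    ∀ i, 1 ≤ i → w i ≠ [] := by
  intro i hi
  induction i using Nat.strong_induction_on with
  | _ i ih =>
    obtain rfl | rfl | ⟨k, hk, rfl⟩ : i = 1 ∨ i = 2 ∨ ∃ k, 1 ≤ k ∧ i = k + 2 := by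
      rcases Nat.lt_or_ge i 3 with h | h
      · omega
      · exact Or.inr (Or.inr ⟨i - 2, by omega, by omega⟩)
    · exact h1
    · exact h2
    · rw [hw k hk]
      exact List.append_ne_nil_of_left_ne_nil (ih (k + 1) (by omega) (by omega)) _

lemma FibWordSeq.le_length (hw : FibWordSeq w) (hne : ∀ i, 1 ≤ i → w i ≠ []) (i : ℕ) :
    i ≤ (w (i + 1)).length := by
  induction i with
  | zero => exact Nat.zero_le _
  | succ i ih =>
    rcases Nat.eq_zero_or_pos i with rfl | hi
    · exact List.length_pos_of_ne_nil (hne 2 (by omega))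
    · have := List.length_pos_of_ne_nil (hne i hi)
      change i + 1 ≤ (w (i + 2)).length
      rw [hw i hi, List.length_append]
      omega

lemma FibWordSeq.prefix (hw : FibWordSeq w) {k m : ℕ} (hk : 2 ≤ k) (hkm : k ≤ m) :
    w k <+: w m := by
  induction m, hkm using Nat.le_induction with
  | base => exact List.prefix_rfl
  | succ m hm ih =>
    obtain ⟨j, rfl⟩ : ∃ j, m = j + 1 := ⟨m - 1, by omega⟩
    refine ih.trans ?_
    change w (j + 1) <+: w (j + 2)
    rw [hw j (by omega)]
    exact List.prefix_append _ _

lemma FibWordSeq.exists_isLimitWord [Inhabited α] (hw : FibWordSeq w)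
    (hne : ∀ i, 1 ≤ i → w i ≠ []) : ∃ b, IsLimitWord w b := by
  refine ⟨fun n => (w (n + 2)).getD (n - 1) default,
    fun n => ⟨n + 2, by omega, (Nat.le_succ n).trans (hw.le_length hne (n + 1))⟩, ?_⟩
  intro k hk j hj
  have hj' : j < (w (j + 1 + 2)).length := by
    have := hw.le_length hne (j + 2)
    change j < (w (j + 2 + 1)).length
    omega
  change _ = (w (j + 1 + 2)).getD j default
  rw [List.getD_eq_getElem _ _ hj', List.get_eq_getElem]
  rcases le_total k (j + 1 + 2) with h | h
  · exact (hw.prefix hk h).getElem hj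
  · exact ((hw.prefix (by omega) h).getElem hj').symm

end FibWords

/-! ### The two implications -/

lemma isAssociated_wordMat {ξ : ℝ} (hξ : Irrational ξ) (h0 : cfA 0 ξ = 0) {w : ℕ → List ℕ+}
    {b : ℕ → ℕ+} (hw : FibWordSeq w) (hcomm : w 1 ++ w 2 ≠ w 2 ++ w 1) (hb : IsLimitWord w b)
    (hcf : ∀ i, 1 ≤ i → cfA i ξ = ((b i : ℕ) : ℤ)) :
    IsAssociated ξ (fun i => wordMat (w i)) ∧ ∀ i, 1 ≤ i → wordMat (w i) ∈ Sset := by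
  have hne := hw.ne_nil (fun h => hcomm (by simp [h])) (fun h => hcomm (by simp [h]))
  set W : ℕ → M2 := fun i => wordMat (w i) with hW
  have hS : ∀ i, 1 ≤ i → W i ∈ Sset := fun i hi => wordMat_mem_Sset (hne i hi)
  have hGL : ∀ i, 1 ≤ i → InGL2Z (W i) := fun i hi => (mem_Sset_iff.1 (hS i hi)).2
  have hfib : ∀ i, 1 ≤ i → W (i + 2) = W (i + 1) * W i := fun i hi => by
    simp only [hW]
    rw [hw i hi, wordMat_append]
  refine ⟨⟨⟨fun i hi => memP_of_inGL2Z (hGL i hi), fun i hi => ?_⟩, fun C => ?_, ?_, ?_⟩, hS⟩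
  · rw [pmul_eq_mul (hGL _ (by omega)) (hGL i hi), hfib i hi]
  · obtain ⟨n, hn⟩ := exists_nat_gt C
    exact ⟨n + 1, by omega, hn.trans_le (natCast_le_mnorm hS hfib n)⟩
  · have hAB : W 1 * W 2 ≠ W 2 * W 1 := by
      simp only [hW]
      rw [← wordMat_append, ← wordMat_append]
      exact fun h => hcomm (wordMat_injective h)
    obtain ⟨N, hN, hs1, hs2, h1, h2, h3⟩ := exists_symmetrizer
      (memP_of_inGL2Z (hGL 1 le_rfl)).2 (memP_of_inGL2Z (hGL 2 (by omega))).2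
      (det_commutator_ne_zero (hS 1 le_rfl) hAB) (by
        obtain ⟨⟨-, -, -, -, h⟩, -⟩ := mem_Sset_iff.1 (hS 1 le_rfl)
        have := (one_le_of_mem_Sset (hS 1 le_rfl)).2.2
        omega)
    refine ⟨N, hN, hs1, hs2, fun i hi => ?_⟩
    induction i using Nat.strong_induction_on with
    | _ i ih =>
      obtain rfl | rfl | rfl | ⟨k, hk, rfl⟩ :
          i = 1 ∨ i = 2 ∨ i = 3 ∨ ∃ k, 1 ≤ k ∧ i = k + 3 := by
        rcases Nat.lt_or_ge i 4 with h | h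
        · omega
        · exact Or.inr (Or.inr (Or.inr ⟨i - 3, by omega, by omega⟩))
      · exact h1
      · exact h2
      · rw [hfib 1 le_rfl]
        exact h3
      · have e : W (k + 3) = W (k + 1) * W k * W (k + 1) := by
          rw [← hfib k hk]
          exact hfib (k + 1) (by omega)
        have i1 := ih k (by omega) hk
        have i2 := ih (k + 1) (by omega) (by omega)
        rw [e]
        rcases Nat.mod_two_eq_zero_or_one k with hpar | hpar
        · rw [if_neg (by omega)] at i1
          rw [if_pos (by omega)] at i2 ⊢
          exact isSymm_fib_step (by rwa [Matrix.transpose_transpose]) i2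
        · rw [if_pos (by omega)] at i1
          rw [if_neg (by omega)] at i2 ⊢
          exact isSymm_fib_step i1 i2
  · obtain ⟨c₁, c₂, hc1, hc2, hc⟩ := exists_norm_bounds hS hfib
    have hx1 : 0 < xiNorm ξ (W 1) := by
      refine lt_of_lt_of_le (abs_pos.2 fun h => ?_) (le_max_left _ _)
      have ha := (one_le_of_mem_Sset (hS 1 le_rfl)).2.2
      refine (hξ.mul_intCast (by omega : W 1 0 0 ≠ 0)).ne_int (W 1 1 0) (by linarith)
    have hn1 : 1 ≤ mnorm (W 1) := one_le_mnorm (hS 1 le_rfl)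
    have hn0 : 0 < mnorm (W 1) := by linarith
    refine ⟨c₁, c₂, min 2⁻¹ (xiNorm ξ (W 1) * mnorm (W 1)),
      max 1 (xiNorm ξ (W 1) * mnorm (W 1)), 1, 1, hc1, hc2, by positivity, by positivity, one_pos,
      one_pos, fun i hi => ⟨(hc i hi).1, (hc i hi).2, ?_⟩⟩
    have hdet : |((W i).det : ℝ)| = 1 := by
      rcases hGL i hi with h | h <;> rw [h] <;> simp
    rw [hdet]
    rw [← and_assoc]
    refine ⟨?_, le_rfl, le_rfl⟩
    have hni : 0 < mnorm (W i) := one_pos.trans_le (one_le_mnorm (hS i hi))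
    have hinv := (inv_pos.2 hni).le
    rcases Nat.lt_or_ge i 2 with h | h
    · obtain rfl : i = 1 := by omega
      rw [← div_eq_mul_inv, ← div_eq_mul_inv, div_le_iff₀ hn0, le_div_iff₀ hn0]
      exact ⟨min_le_right _ _, le_max_right _ _⟩
    · obtain ⟨k1, k2⟩ := xiNorm_wordMat_bounds hξ h0 (hne i hi) (fun j hj => by
        rw [hcf (j + 1) (by omega), ← hb.2 i h j hj, List.get_eq_getElem])
      constructor
      · exact (mul_le_mul_of_nonneg_right (min_le_left _ _) hinv).trans k1
      · refine k2.trans ?_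
        exact le_mul_of_one_le_left hinv (le_max_left _ _)

lemma not_commute_of_isExtremal {ξ : ℝ} (hξ : IsExtremal ξ) {W : ℕ → M2}
    (hS : ∀ i, 1 ≤ i → W i ∈ Sset) (hfib : ∀ i, 1 ≤ i → W (i + 2) = W (i + 1) * W i) {c : ℝ}
    (hc : ∀ i, 1 ≤ i → xiNorm ξ (W i) ≤ c * (mnorm (W i))⁻¹) : W 1 * W 2 ≠ W 2 * W 1 := by
  intro hcomm
  have hall : ∀ i, 1 ≤ i → W 1 * W i = W i * W 1 := by
    intro i hi
    induction i using Nat.strong_induction_on with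
    | _ i ih =>
      obtain rfl | rfl | ⟨k, hk, rfl⟩ : i = 1 ∨ i = 2 ∨ ∃ k, 1 ≤ k ∧ i = k + 2 := by
        rcases Nat.lt_or_ge i 3 with h | h
        · omega
        · exact Or.inr (Or.inr ⟨i - 2, by omega, by omega⟩)
      · rfl
      · exact hcomm
      · have h1 := ih k (by omega) hk
        have h2 := ih (k + 1) (by omega) (by omega)
        rw [hfib k hk, ← mul_assoc, h2, mul_assoc, h1, mul_assoc]
  have hb := (one_le_of_mem_Sset (hS 1 le_rfl)).1
  set A := W 1 with hA
  have hquad : (A 0 1 : ℝ) * ξ ^ 2 + (A 0 0 - A 1 1) * ξ + -(A 1 0) ≠ 0 := by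
    have := hξ.1 (A 0 1) (A 0 0 - A 1 1) (-(A 1 0)) (by
      rintro ⟨h, -⟩
      have : A 0 1 = 0 := by exact_mod_cast h
      omega)
    push_cast at this
    exact this
  set t := (A 0 1 : ℝ) * ξ ^ 2 + (A 0 0 - A 1 1) * ξ + -(A 1 0) with ht
  set M := |(A 0 0 : ℝ)| + |(A 1 0 : ℝ)| + |ξ * A 0 1 - A 1 1| with hM
  have hle : ∀ n : ℕ, (n : ℝ) * |t| ≤ M * |c| := by
    intro n
    have hn := natCast_le_mnorm hS hfib n
    have h1 := hc (n + 1) (by omega)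
    have hw := one_le_mnorm (hS (n + 1) (by omega))
    have hmn := mnorm_eq_of_mem_Sset (hS (n + 1) (by omega))
    have hcm := congrFun (congrFun (hall (n + 1) (by omega)) 0) 0
    have hcm' := congrFun (congrFun (hall (n + 1) (by omega)) 1) 0
    generalize W (n + 1) = B at *
    have e0 : |ξ * B 0 0 - B 1 0| ≤ |c| := by
      refine (le_max_left _ _).trans (h1.trans ?_)
      refine (mul_le_mul_of_nonneg_right (le_abs_self c) (by positivity)).trans ?_
      exact mul_le_of_le_one_right (abs_nonneg c) (inv_le_one_of_one_le₀ hw)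
    have e1 : |ξ * B 0 1 - B 1 1| ≤ |c| := by
      refine (le_max_right _ _).trans (h1.trans ?_)
      refine (mul_le_mul_of_nonneg_right (le_abs_self c) (by positivity)).trans ?_
      exact mul_le_of_le_one_right (abs_nonneg c) (inv_le_one_of_one_le₀ hw)
    simp only [Matrix.mul_apply, Fin.sum_univ_two] at hcm hcm'
    have hcm : (A 0 0 * B 0 0 + A 0 1 * B 1 0 : ℝ) = B 0 0 * A 0 0 + B 0 1 * A 1 0 := by
      exact_mod_cast hcm
    have hcm' : (A 1 0 * B 0 0 + A 1 1 * B 1 0 : ℝ) = B 1 0 * A 0 0 + B 1 1 * A 1 0 := by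
      exact_mod_cast hcm'
    have key : (B 0 0 : ℝ) * t = A 0 0 * (ξ * B 0 0 - B 1 0) + A 1 0 * (ξ * B 0 1 - B 1 1) +
        (ξ * A 0 1 - A 1 1) * (ξ * B 0 0 - B 1 0) := by
      rw [ht]
      linear_combination ξ * hcm - hcm'
    calc (n : ℝ) * |t| ≤ B 0 0 * |t| := by
          rw [← hmn]
          gcongr
      _ = |(B 0 0 : ℝ) * t| := by
          rw [abs_mul, abs_of_nonneg (show (0 : ℝ) ≤ B 0 0 by rw [← hmn]; linarith)]
      _ ≤ |(A 0 0 : ℝ)| * |ξ * B 0 0 - B 1 0| + |(A 1 0 : ℝ)| * |ξ * B 0 1 - B 1 1| +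
          |ξ * A 0 1 - A 1 1| * |ξ * B 0 0 - B 1 0| := by
          rw [key, ← abs_mul, ← abs_mul, ← abs_mul]
          exact abs_add_three _ _ _
      _ ≤ |(A 0 0 : ℝ)| * |c| + |(A 1 0 : ℝ)| * |c| + |ξ * A 0 1 - A 1 1| * |c| := by
          gcongr
      _ = M * |c| := by rw [hM]; ring
  obtain ⟨n, hn⟩ := exists_nat_gt (M * |c| / |t|)
  rw [div_lt_iff₀ (abs_pos.2 hquad)] at hn
  exact absurd (hle n) (not_le.2 hn)

lemma exists_fibWordSeq_of_isAssociated {ξ : ℝ} (hξ : Irrational ξ) (hext : IsExtremal ξ)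
    {W : ℕ → M2} (hW : IsAssociated ξ W) (hS : ∀ i, 1 ≤ i → W i ∈ Sset) :
    cfA 0 ξ = 0 ∧ ∃ (w : ℕ → List ℕ+) (b : ℕ → ℕ+),
      FibWordSeq w ∧ w 1 ++ w 2 ≠ w 2 ++ w 1 ∧ IsLimitWord w b ∧
      ∀ i, 1 ≤ i → cfA i ξ = ((b i : ℕ) : ℤ) := by
  obtain ⟨⟨-, hpm⟩, -, -, c₁, c₂, c₃, c, c₅, c₆, -, -, -, hc0, -, -, hc⟩ := hW
  have hGL : ∀ i, 1 ≤ i → InGL2Z (W i) := fun i hi => (mem_Sset_iff.1 (hS i hi)).2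
  have hfib : ∀ i, 1 ≤ i → W (i + 2) = W (i + 1) * W i := fun i hi => by
    rw [hpm i hi, pmul_eq_mul (hGL _ (by omega)) (hGL i hi)]
  have hxi : ∀ i, 1 ≤ i → xiNorm ξ (W i) ≤ c * (mnorm (W i))⁻¹ := fun i hi => (hc i hi).2.2.2.1
  have hex : ∀ i, ∃ l : List ℕ+, 1 ≤ i → l ≠ [] ∧ wordMat l = W i := by
    intro i
    by_cases hi : 1 ≤ i
    · obtain ⟨l, hl⟩ := exists_wordMat_eq (hS i hi)
      exact ⟨l, fun _ => hl⟩
    · exact ⟨[], fun h => absurd h hi⟩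
  choose w hw' using hex
  have hne : ∀ i, 1 ≤ i → w i ≠ [] := fun i hi => (hw' i hi).1
  have hw : FibWordSeq w := fun i hi => wordMat_injective (by
    rw [wordMat_append, (hw' _ (by omega)).2, (hw' _ (by omega)).2, (hw' i hi).2, hfib i hi])
  obtain ⟨b, hb⟩ := hw.exists_isLimitWord hne
  have happrox : ∀ ε : ℝ, 0 < ε → ∀ m : ℕ, ∃ l : List ℕ+, m ≤ l.length ∧
      (∀ j (h : j < l.length), l[j] = b (j + 1)) ∧
      |ξ * (wordMat l 0 0 : ℝ) - (wordMat l 1 0 : ℝ)| < ε := by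
    intro ε hε m
    obtain ⟨n, hn⟩ := exists_nat_gt (c / ε)
    have hlen := hw.le_length hne (n + m + 1)
    refine ⟨w (n + m + 2), by change m ≤ (w (n + m + 1 + 1)).length; omega,
      fun j hj => hb.2 (n + m + 2) (by omega) j hj, ?_⟩
    rw [(hw' (n + m + 2) (by omega)).2]
    have hnorm := natCast_le_mnorm hS hfib (n + m + 1)
    change _ ≤ mnorm (W (n + m + 2)) at hnorm
    have hpos : 0 < mnorm (W (n + m + 2)) :=
      one_pos.trans_le (one_le_mnorm (hS _ (by omega)))
    refine ((le_max_left _ _).trans (hxi (n + m + 2) (by omega))).trans_lt ?_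
    rw [← div_eq_mul_inv, div_lt_comm₀ hpos hε]
    refine hn.trans_le (le_trans ?_ hnorm)
    exact_mod_cast (by omega : n ≤ n + m + 1)
  refine ⟨(cfA_eq_of_approx 0 ξ b hξ happrox).1, w, b, hw, fun h => ?_, hb, fun i hi => ?_⟩
  · refine not_commute_of_isExtremal hext hS hfib hxi ?_
    rw [← (hw' 1 le_rfl).2, ← (hw' 2 (by omega)).2, ← wordMat_append, ← wordMat_append, h]
  · obtain ⟨k, rfl⟩ : ∃ k, i = k + 1 := ⟨i - 1, by omega⟩
    exact (cfA_eq_of_approx k ξ b hξ happrox).2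

/-- An irrational real ξ is extremal with an associated Fibonacci sequence in 𝒮 iff its
continued fraction expansion is [0, a₁, a₂, …] where (a₁, a₂, …) is the limit of a Fibonacci
sequence of words over the positive integers starting with two non-commuting words. -/
theorem stmt13 (ξ : ℝ) (hirr : Irrational ξ) :
    (IsExtremal ξ ∧ ∃ W : ℕ → M2, IsAssociated ξ W ∧ ∀ i, 1 ≤ i → W i ∈ Sset) ↔
    (cfA 0 ξ = 0 ∧ ∃ (w : ℕ → List ℕ+) (b : ℕ → ℕ+),
      FibWordSeq w ∧ w 1 ++ w 2 ≠ w 2 ++ w 1 ∧ IsLimitWord w b ∧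
      ∀ i, 1 ≤ i → cfA i ξ = ((b i : ℕ) : ℤ)) := by
  constructor
  · rintro ⟨hext, W, hW, hS⟩
    exact exists_fibWordSeq_of_isAssociated hirr hext hW hS
  · rintro ⟨h0, w, b, hw, hcomm, hb, hcf⟩
    obtain ⟨hW, hS⟩ := isAssociated_wordMat hirr h0 hw hcomm hb hcf
    have hfib : ∀ i, 1 ≤ i → wordMat (w (i + 2)) = wordMat (w (i + 1)) * wordMat (w i) :=
      fun i hi => by rw [hw i hi, wordMat_append]
    exact ⟨isExtremal_of_isAssociated hS hfib hW, _, hW, hS⟩
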